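/- arXiv:2305.00367 — 2 statements merged into one kernel-verified Lean document; each statement's English description precedes it below -/
import Mathlib

section
/- Let c ≥ 0, let 0 ≤ p_n ≤ 1/2 for n = 1,…,N, and let (a_n)_{n=1}^N and (b_n)_{n=1}^N be nonnegative reals such that (Σ_{n=1}^N (1/2 − p_n) a_n)² ≥ c·Σ_{n=1}^N a_n² and (Σ_{n=1}^N (1/2 − p_n) b_n)² ≥ c·Σ_{n=1}^N b_n². Then (Σ_{n=1}^N (1/2 − p_n)(a_n + b_n))² ≥ c·Σ_{n=1}^N (a_n + b_n)². -/
open Finset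

/-- Merging lemma: if two shards each satisfy the security constraint (with
constant `c = -(1/2)·ln τ ≥ 0`), then their componentwise sum also does. -/
theorem merge_shards_secure
    (N : ℕ) (c : ℝ) (hc : 0 ≤ c)
    (p : Fin N → ℝ) (hp0 : ∀ n, 0 ≤ p n) (hphalf : ∀ n, p n ≤ 1 / 2)
    (a b : Fin N → ℝ) (ha : ∀ n, 0 ≤ a n) (hb : ∀ n, 0 ≤ b n)
    (hsa : (∑ n, (1 / 2 - p n) * a n) ^ 2 ≥ c * ∑ n, (a n) ^ 2)
    (hsb : (∑ n, (1 / 2 - p n) * b n) ^ 2 ≥ c * ∑ n, (b n) ^ 2) :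
    (∑ n, (1 / 2 - p n) * (a n + b n)) ^ 2 ≥ c * ∑ n, (a n + b n) ^ 2 := by
  have hA : 0 ≤ ∑ n, (1 / 2 - p n) * a n :=
    sum_nonneg fun n _ => mul_nonneg (sub_nonneg.2 (hphalf n)) (ha n)
  have hB : 0 ≤ ∑ n, (1 / 2 - p n) * b n :=
    sum_nonneg fun n _ => mul_nonneg (sub_nonneg.2 (hphalf n)) (hb n)
  have hcross : c * ∑ n, a n * b n ≤
      (∑ n, (1 / 2 - p n) * a n) * ∑ n, (1 / 2 - p n) * b n := by
    refine le_of_abs_le (abs_le_of_sq_le_sq ?_ (mul_nonneg hA hB))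
    calc (c * ∑ n, a n * b n) ^ 2
        = c ^ 2 * (∑ n, a n * b n) ^ 2 := by ring
      _ ≤ c ^ 2 * ((∑ n, (a n) ^ 2) * ∑ n, (b n) ^ 2) :=
          mul_le_mul_of_nonneg_left (sum_mul_sq_le_sq_mul_sq univ a b) (sq_nonneg c)
      _ = (c * ∑ n, (a n) ^ 2) * (c * ∑ n, (b n) ^ 2) := by ring
      _ ≤ (∑ n, (1 / 2 - p n) * a n) ^ 2 * (∑ n, (1 / 2 - p n) * b n) ^ 2 :=
          mul_le_mul hsa hsb
            (mul_nonneg hc (sum_nonneg fun n _ => sq_nonneg (b n))) (sq_nonneg _)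
      _ = ((∑ n, (1 / 2 - p n) * a n) * ∑ n, (1 / 2 - p n) * b n) ^ 2 := by ring
  have hlin : ∑ n, (1 / 2 - p n) * (a n + b n) =
      ∑ n, (1 / 2 - p n) * a n + ∑ n, (1 / 2 - p n) * b n := by
    simp only [mul_add, sum_add_distrib]
  have hsq : ∑ n, (a n + b n) ^ 2 =
      ∑ n, (a n) ^ 2 + 2 * ∑ n, a n * b n + ∑ n, (b n) ^ 2 := by
    simp only [add_sq, sum_add_distrib, mul_sum, mul_assoc]
  rw [hlin, hsq]
  linarith [add_sq (∑ n, (1 / 2 - p n) * a n) (∑ n, (1 / 2 - p n) * b n)]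
end

section
/- Let τ ∈ (0, 1], let 0 ≤ p_n ≤ 1/2 and η_n ≥ 0 for n = 1,…,N, and let σ ≥ 1 be an integer. If there exists a score allocation of (η_n) into σ + 1 shards in which every shard satisfies the security constraint, then there exists a score allocation of (η_n) into σ shards in which every shard satisfies the security constraint. -/
open Finset

/-- The security inequality `c * ‖a‖² ≤ ⟪w, a⟫²` is preserved under addition of vectors whose
pairings with `w` are nonnegative. -/
theorem mul_sum_sq_add_le {ι : Type*} [Fintype ι] {c : ℝ} (hc : 0 ≤ c) (w a b : ι → ℝ)
    (hA : 0 ≤ ∑ n, w n * a n) (hB : 0 ≤ ∑ n, w n * b n)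
    (ha : c * ∑ n, a n ^ 2 ≤ (∑ n, w n * a n) ^ 2)
    (hb : c * ∑ n, b n ^ 2 ≤ (∑ n, w n * b n) ^ 2) :
    c * ∑ n, (a n + b n) ^ 2 ≤ (∑ n, w n * (a n + b n)) ^ 2 := by
  have cross : c * ∑ n, a n * b n ≤ (∑ n, w n * a n) * ∑ n, w n * b n := by
    refine le_of_abs_le (abs_le_of_sq_le_sq ?_ (mul_nonneg hA hB))
    calc (c * ∑ n, a n * b n) ^ 2
        = c ^ 2 * (∑ n, a n * b n) ^ 2 := mul_pow _ _ _
      _ ≤ c ^ 2 * ((∑ n, a n ^ 2) * ∑ n, b n ^ 2) := by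
          gcongr
          exact sum_mul_sq_le_sq_mul_sq _ _ _
      _ = (c * ∑ n, a n ^ 2) * (c * ∑ n, b n ^ 2) := by ring
      _ ≤ (∑ n, w n * a n) ^ 2 * (∑ n, w n * b n) ^ 2 := by gcongr
      _ = ((∑ n, w n * a n) * ∑ n, w n * b n) ^ 2 := (mul_pow _ _ _).symm
  have hsq : ∑ n, (a n + b n) ^ 2
      = ∑ n, a n ^ 2 + 2 * ∑ n, a n * b n + ∑ n, b n ^ 2 := by
    rw [mul_sum, ← sum_add_distrib, ← sum_add_distrib]
    exact sum_congr rfl fun n _ => by ring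
  have hlin : ∑ n, w n * (a n + b n) = ∑ n, w n * a n + ∑ n, w n * b n := by
    simp only [mul_add, sum_add_distrib]
  rw [hsq, hlin]
  linarith

/-- Monotonicity of feasibility in the number of shards: if the scores can be
securely allocated into `σ + 1` shards, they can be securely allocated into
`σ` shards. -/
theorem secure_allocation_mono
    (N σ : ℕ) (hσ : 1 ≤ σ) (τ : ℝ) (hτ : τ ∈ Set.Ioc (0 : ℝ) 1)
    (p : Fin N → ℝ) (hp0 : ∀ n, 0 ≤ p n) (hphalf : ∀ n, p n ≤ 1 / 2)
    (η : Fin N → ℝ) (hη : ∀ n, 0 ≤ η n)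
    (hex : ∃ η' : Fin (σ + 1) → Fin N → ℝ,
      (∀ s n, 0 ≤ η' s n) ∧ (∀ n, ∑ s, η' s n = η n) ∧
      (∀ s, (∑ n, (1 / 2 - p n) * η' s n) ^ 2
          ≥ -(1 / 2) * Real.log τ * ∑ n, (η' s n) ^ 2)) :
    ∃ η'' : Fin σ → Fin N → ℝ,
      (∀ s n, 0 ≤ η'' s n) ∧ (∀ n, ∑ s, η'' s n = η n) ∧
      (∀ s, (∑ n, (1 / 2 - p n) * η'' s n) ^ 2
          ≥ -(1 / 2) * Real.log τ * ∑ n, (η'' s n) ^ 2) := by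
  obtain ⟨η', hpos, hsum, hsec⟩ := hex
  obtain ⟨k, rfl⟩ := Nat.exists_eq_add_of_le' hσ
  have hc : 0 ≤ -(1 / 2) * Real.log τ := by
    linarith [Real.log_nonpos hτ.1.le hτ.2]
  have hpair : ∀ s, 0 ≤ ∑ n, (1 / 2 - p n) * η' s n := fun s =>
    sum_nonneg fun n _ => mul_nonneg (sub_nonneg.2 (hphalf n)) (hpos s n)
  refine ⟨Fin.cons (fun n => η' 0 n + η' 1 n) fun i => η' i.succ.succ, ?_, fun n => ?_, ?_⟩
  · exact Fin.cases (fun n => add_nonneg (hpos 0 n) (hpos 1 n)) fun i => hpos i.succ.succ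
  · rw [← hsum n]
    simp [Fin.sum_univ_succ, add_assoc]
  · exact Fin.cases
      (mul_sum_sq_add_le hc _ _ _ (hpair 0) (hpair 1) (hsec 0) (hsec 1))
      fun i => hsec i.succ.succ
end
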